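/- arXiv:2509.16693 — 7 statements merged into one kernel-verified Lean document; each statement's English description precedes it below -/
import Mathlib

section
/- Let c ∈ (0,√2), d₂ > 0 and n₂ ∈ ℕ with 2πñ₂ ≥ c, where ñ₂ = n₂/(2d₂). Then ∫_ℝ l_{n₂}(ξ)⁻² dξ ≤ 5/(8(2πñ₂)⁷), where l_{n₂}(ξ) = (2π)⁴(ξ² + ñ₂²)² − c²(2πξ)² + 1. -/
open Real MeasureTheory

/-- For `2πntil₂ ≥ c`, the squared `L²(ℝ)` norm of `1/l_{n₂}` is bounded:
`∫_ℝ l_{n₂}(ξ)⁻² dξ ≤ 5/(8(2πntil₂)⁷)`. -/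
theorem stmt_5 (c d₂ : ℝ) (hc : c ∈ Set.Ioo 0 (Real.sqrt 2)) (hd₂ : 0 < d₂)
    (n₂ : ℕ) (hn₂ : 1 ≤ n₂) (ntil : ℝ) (hntil : ntil = (n₂ : ℝ) / (2 * d₂))
    (h : c ≤ 2 * π * ntil) :
    ∫ ξ : ℝ, (1 / ((2 * π) ^ 4 * (ξ ^ 2 + ntil ^ 2) ^ 2 - c ^ 2 * (2 * π * ξ) ^ 2 + 1)) ^ 2
      ≤ 5 / (8 * (2 * π * ntil) ^ 7) := by
  have hn : 0 < ntil := by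
    rw [hntil]
    have : (0 : ℝ) < n₂ := by exact_mod_cast hn₂
    positivity
  have hpi := Real.pi_pos
  have ha : 0 < 2 * π * ntil := by positivity
  have hc2 : c ^ 2 ≤ (2 * π * ntil) ^ 2 := pow_le_pow_left₀ hc.1.le h 2
  have hint : Integrable (fun ξ : ℝ => (1 / (2 * π * ntil) ^ 8) * (1 + (ξ / ntil) ^ 2)⁻¹) :=
    ((integrable_inv_one_add_sq).comp_div hn.ne').const_mul _
  have key : ∫ ξ : ℝ, (1 / (2 * π * ntil) ^ 8) * (1 + (ξ / ntil) ^ 2)⁻¹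
      = 1 / (2 * (2 * π * ntil) ^ 7) := by
    rw [integral_const_mul, Measure.integral_comp_div (fun t : ℝ => (1 + t ^ 2)⁻¹) ntil,
      integral_univ_inv_one_add_sq, abs_of_pos hn, smul_eq_mul]
    field_simp
  have hmono : ∫ ξ : ℝ,
      (1 / ((2 * π) ^ 4 * (ξ ^ 2 + ntil ^ 2) ^ 2 - c ^ 2 * (2 * π * ξ) ^ 2 + 1)) ^ 2
      ≤ ∫ ξ : ℝ, (1 / (2 * π * ntil) ^ 8) * (1 + (ξ / ntil) ^ 2)⁻¹ := by
    refine integral_mono_of_nonneg (Filter.Eventually.of_forall fun ξ => sq_nonneg _) hint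
      (Filter.Eventually.of_forall fun ξ => ?_)
    obtain ⟨t, rfl⟩ : ∃ t, ξ = t * ntil := ⟨ξ / ntil, by field_simp⟩
    have e : t * ntil / ntil = t := by field_simp
    simp only [e]
    have h1 : (2 * π * ntil) ^ 4 * (1 + t ^ 2) ≤ (2 * π) ^ 4 * ((t * ntil) ^ 2 + ntil ^ 2) ^ 2
        - c ^ 2 * (2 * π * (t * ntil)) ^ 2 + 1 := by
      have h2 := mul_le_mul_of_nonneg_right hc2 (sq_nonneg (2 * π * (t * ntil)))
      have h3 : 0 ≤ (2 * π * ntil) ^ 4 * t ^ 4 := by positivity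
      nlinarith
    have h4 : 0 < (2 * π * ntil) ^ 4 * (1 + t ^ 2) := by positivity
    rw [div_pow, one_pow, ← one_div, one_div_mul_one_div]
    apply one_div_le_one_div_of_le (by positivity)
    refine le_trans ?_ (pow_le_pow_left₀ h4.le h1 2)
    rw [mul_pow (_ ^ 4), ← pow_mul]
    refine mul_le_mul_of_nonneg_left ?_ (by positivity)
    nlinarith [sq_nonneg t, sq_nonneg (t ^ 2)]
  refine hmono.trans ?_
  rw [key, div_le_div_iff₀ (by positivity) (by positivity)]
  have : 0 < (2 * π * ntil) ^ 7 := by positivity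
  linarith
end

section
/- Let c ∈ (0,√2), d₂ > 0, and let N ∈ ℕ satisfy N > d₂c/π. Then ∑_{n₂=N+1}^∞ ∫_ℝ l_{n₂}(ξ)⁻² dξ ≤ 5(2d₂)⁷/(48(2π)⁷N⁶), where l_{n₂}(ξ) = (2π)⁴(ξ² + ñ₂²)² − c²(2πξ)² + 1 and ñ₂ = n₂/(2d₂). -/
open Real MeasureTheory


lemma aux_int : Integrable (fun x : ℝ => ((1 + x ^ 2) ^ 4)⁻¹) := by
  refine integrable_inv_one_add_sq.mono' ?_ ?_
  · apply Continuous.aestronglyMeasurable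
    exact Continuous.inv₀ (by fun_prop) (fun x => by positivity)
  · refine Filter.Eventually.of_forall (fun x => ?_)
    rw [Real.norm_of_nonneg (by positivity)]
    apply inv_anti₀ (by positivity)
    exact le_self_pow₀ (by nlinarith [sq_nonneg x]) (by norm_num)

lemma aux_lim (l : Filter ℝ) (hl : Filter.Tendsto (fun x : ℝ => x⁻¹) l (nhds 0)) (k : ℕ) :
    Filter.Tendsto (fun x : ℝ => x / (1 + x ^ 2) ^ (k + 1)) l (nhds 0) := by
  refine squeeze_zero_norm (a := fun x => |x⁻¹|) (fun x => ?_) (by simpa using hl.abs)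
  rw [Real.norm_eq_abs, abs_div, abs_inv, abs_of_pos (by positivity : 0 < (1 + x ^ 2) ^ (k + 1))]
  rcases eq_or_ne x 0 with h | h
  · simp [h]
  · have hx : 0 < |x| := abs_pos.mpr h
    rw [div_le_iff₀ (by positivity), inv_mul_eq_div, le_div_iff₀ hx]
    have h1 : 1 + x ^ 2 ≤ (1 + x ^ 2) ^ (k + 1) :=
      le_self_pow₀ (by nlinarith [sq_nonneg x]) (by norm_num)
    nlinarith [abs_mul_abs_self x]

lemma aux_val : ∫ x : ℝ, ((1 + x ^ 2) ^ 4)⁻¹ = 5 * π / 16 := by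
  have hd : ∀ x : ℝ, HasDerivAt (fun x : ℝ => 5 / 16 * arctan x + (1 / 6 * (x / (1 + x ^ 2) ^ (2 + 1))
      + 5 / 24 * (x / (1 + x ^ 2) ^ (1 + 1)) + 5 / 16 * (x / (1 + x ^ 2) ^ (0 + 1))))
      (((1 + x ^ 2) ^ 4)⁻¹) x := by
    intro x
    have hp : HasDerivAt (fun x : ℝ => 1 + x ^ 2) (2 * x) x := by
      simpa using (hasDerivAt_pow 2 x).const_add 1
    have hne : (1 + x ^ 2) ≠ 0 := by positivity
    have hq : ∀ k : ℕ, HasDerivAt (fun x : ℝ => x / (1 + x ^ 2) ^ (k + 1)) _ x := fun k =>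
      (hasDerivAt_id x).fun_div (hp.fun_pow (k + 1)) (pow_ne_zero _ hne)
    have := ((hasDerivAt_arctan x).const_mul (5 / 16)).fun_add
      ((((hq 2).const_mul (1 / 6)).fun_add ((hq 1).const_mul (5 / 24))).fun_add
        ((hq 0).const_mul (5 / 16)))
    refine this.congr_deriv ?_
    simp only [id]
    push_cast
    field_simp
    ring
  have ht : ∀ (l : Filter ℝ) (a : ℝ), Filter.Tendsto (fun x : ℝ => x⁻¹) l (nhds 0) →
      Filter.Tendsto arctan l (nhds a) →
      Filter.Tendsto (fun x : ℝ => 5 / 16 * arctan x + (1 / 6 * (x / (1 + x ^ 2) ^ (2 + 1))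
      + 5 / 24 * (x / (1 + x ^ 2) ^ (1 + 1)) + 5 / 16 * (x / (1 + x ^ 2) ^ (0 + 1)))) l
      (nhds (5 / 16 * a)) := by
    intro l a h1 h2
    have := (h2.const_mul (5 / 16)).add ((((aux_lim l h1 2).const_mul (1 / 6)).add
      ((aux_lim l h1 1).const_mul (5 / 24))).add ((aux_lim l h1 0).const_mul (5 / 16)))
    simpa using this
  rw [integral_of_hasDerivAt_of_tendsto hd aux_int
    (ht _ _ tendsto_inv_atBot_zero (tendsto_arctan_atBot.mono_right nhdsWithin_le_nhds))
    (ht _ _ tendsto_inv_atTop_zero (tendsto_arctan_atTop.mono_right nhdsWithin_le_nhds))]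
  ring

lemma aux_scale (b : ℝ) (hb : 0 < b) :
    Integrable (fun x : ℝ => ((x ^ 2 + b ^ 2) ^ 4)⁻¹) ∧
    ∫ x : ℝ, ((x ^ 2 + b ^ 2) ^ 4)⁻¹ = 5 * π / (16 * b ^ 7) := by
  have h : (fun x : ℝ => ((x ^ 2 + b ^ 2) ^ 4)⁻¹) =
      fun x => (b ^ 8)⁻¹ * ((1 + (x / b) ^ 2) ^ 4)⁻¹ := by
    funext x
    rw [← mul_inv]
    congr 1
    field_simp
    ring
  rw [h]
  refine ⟨(aux_int.comp_div hb.ne').const_mul _, ?_⟩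
  rw [integral_const_mul, Measure.integral_comp_div (fun x : ℝ => ((1 + x ^ 2) ^ 4)⁻¹) b, aux_val,
    abs_of_pos hb, smul_eq_mul]
  field_simp

lemma aux_term (c b : ℝ) (hb : 0 < b) (hc : 0 < c) (h : c ≤ 2 * π * b) :
    ∫ ξ : ℝ, (1 / ((2 * π) ^ 4 * (ξ ^ 2 + b ^ 2) ^ 2 - c ^ 2 * (2 * π * ξ) ^ 2 + 1)) ^ 2
      ≤ 5 / (8 * (2 * π) ^ 7 * b ^ 7) := by
  obtain ⟨hi, hv⟩ := aux_scale b hb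
  have hpi := pi_pos
  calc _ ≤ ∫ ξ : ℝ, (4 / (2 * π) ^ 8) * ((ξ ^ 2 + b ^ 2) ^ 4)⁻¹ := by
        apply integral_mono_of_nonneg (Filter.Eventually.of_forall fun x => by positivity)
          (hi.const_mul _)
        refine Filter.Eventually.of_forall fun x => ?_
        simp only
        have hl : (2 * π) ^ 4 * (x ^ 2 + b ^ 2) ^ 2 / 2 ≤
            (2 * π) ^ 4 * (x ^ 2 + b ^ 2) ^ 2 - c ^ 2 * (2 * π * x) ^ 2 + 1 := by
          have h1 : c ^ 2 * (2 * π * x) ^ 2 ≤ (2 * π * b) ^ 2 * (2 * π * x) ^ 2 := by gcongr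
          have h2 : (0:ℝ) ≤ (2 * π) ^ 4 * (x ^ 4 + b ^ 4) := by positivity
          nlinarith
        have hpos : 0 < (2 * π) ^ 4 * (x ^ 2 + b ^ 2) ^ 2 / 2 := by positivity
        calc _ ≤ (1 / ((2 * π) ^ 4 * (x ^ 2 + b ^ 2) ^ 2 / 2)) ^ 2 := by
              have := one_div_le_one_div_of_le hpos hl
              have h0 : 0 ≤ 1 / ((2 * π) ^ 4 * (x ^ 2 + b ^ 2) ^ 2
                - c ^ 2 * (2 * π * x) ^ 2 + 1) := by
                have := hpos.trans_le hl
                positivity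
              gcongr
          _ = _ := by
              field_simp
              norm_num
    _ = _ := by
        rw [integral_const_mul, hv]
        field_simp
        norm_num

lemma aux_tel (t : ℝ) (ht : 0 < t) :
    1 / (t + 1) ^ 7 ≤ 1 / 6 * (1 / t ^ 6 - 1 / (t + 1) ^ 6) := by
  have : 1 / 6 * (1 / t ^ 6 - 1 / (t + 1) ^ 6) - 1 / (t + 1) ^ 7 =
      (21 * t ^ 5 + 35 * t ^ 4 + 35 * t ^ 3 + 21 * t ^ 2 + 7 * t + 1) /
        (6 * t ^ 6 * (t + 1) ^ 7) := by
    field_simp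
    ring
  have h2 : 0 ≤ (21 * t ^ 5 + 35 * t ^ 4 + 35 * t ^ 3 + 21 * t ^ 2 + 7 * t + 1) /
        (6 * t ^ 6 * (t + 1) ^ 7) := by positivity
  linarith

/-- Tail estimate: for `N > d₂c/π`,
`∑_{n₂=N+1}^∞ ∫_ℝ l_{n₂}(ξ)⁻² dξ ≤ 5(2d₂)⁷/(48(2π)⁷N⁶)`,
where `l_{n₂}(ξ) = (2π)⁴(ξ² + ñ₂²)² − c²(2πξ)² + 1` and `ñ₂ = n₂/(2d₂)`. -/
theorem stmt_6 (c d₂ : ℝ) (hc : c ∈ Set.Ioo 0 (Real.sqrt 2)) (hd₂ : 0 < d₂)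
    (N : ℕ) (hN : d₂ * c / π < (N : ℝ)) :
    ∑' k : ℕ,
        ∫ ξ : ℝ,
          (1 / ((2 * π) ^ 4 * (ξ ^ 2 + (((N + 1 + k : ℕ) : ℝ) / (2 * d₂)) ^ 2) ^ 2
              - c ^ 2 * (2 * π * ξ) ^ 2 + 1)) ^ 2
      ≤ 5 * (2 * d₂) ^ 7 / (48 * (2 * π) ^ 7 * (N : ℝ) ^ 6) := by
  have hpi := pi_pos
  have hc0 : 0 < c := hc.1
  have hNpos : (0 : ℝ) < N := lt_of_le_of_lt (by positivity) hN
  have key : d₂ * c < N * π := (div_lt_iff₀ hpi).mp hN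
  set C : ℝ := 5 * (2 * d₂) ^ 7 / (8 * (2 * π) ^ 7) with hC
  have hCpos : 0 < C := by positivity
  refine Real.tsum_le_of_sum_range_le
    (fun k => integral_nonneg fun ξ => by positivity) (fun m => ?_)
  have hsum : ∀ m : ℕ, ∑ k ∈ Finset.range m,
      ∫ ξ : ℝ,
          (1 / ((2 * π) ^ 4 * (ξ ^ 2 + (((N + 1 + k : ℕ) : ℝ) / (2 * d₂)) ^ 2) ^ 2
              - c ^ 2 * (2 * π * ξ) ^ 2 + 1)) ^ 2
      ≤ C * (1 / 6 * (1 / (N : ℝ) ^ 6 - 1 / ((N : ℝ) + m) ^ 6)) := by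
    intro m
    induction m with
    | zero => simp
    | succ m ih =>
      rw [Finset.sum_range_succ]
      have h1 := aux_term c (((N + 1 + m : ℕ) : ℝ) / (2 * d₂)) (by positivity) hc0 (by
        push_cast
        rw [← mul_div_assoc, le_div_iff₀ (by positivity)]
        have : 0 ≤ π * (1 + (m : ℝ)) := by positivity
        nlinarith)
      have h2 := aux_tel ((N : ℝ) + m) (by positivity)
      have h3 : 5 / (8 * (2 * π) ^ 7 * (((N + 1 + m : ℕ) : ℝ) / (2 * d₂)) ^ 7) =
          C * (1 / ((N : ℝ) + m + 1) ^ 7) := by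
        rw [hC]
        have : ((N + 1 + m : ℕ) : ℝ) = (N : ℝ) + m + 1 := by push_cast; ring
        rw [this]
        field_simp
      rw [h3] at h1
      have h4 := mul_le_mul_of_nonneg_left h2 hCpos.le
      have h5 : ((N : ℝ) + ((m + 1 : ℕ) : ℝ)) = (N : ℝ) + m + 1 := by push_cast; ring
      rw [h5]
      linarith
  refine (hsum m).trans ?_
  have h6 : 5 * (2 * d₂) ^ 7 / (48 * (2 * π) ^ 7 * (N : ℝ) ^ 6) =
      C * (1 / 6 * (1 / (N : ℝ) ^ 6)) := by
    rw [hC]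
    field_simp
    norm_num
  rw [h6]
  have : 0 ≤ 1 / ((N : ℝ) + m) ^ 6 := by positivity
  gcongr
  linarith
end

section
/- Let c ∈ (0,√2) and m ≥ 0. Define S = √((c² − 2m²)² + 4(1 + c²m²) − c⁴), b = (1/2)√(c² − 2m² + S), and a = √(4(1 + m²c²) − c⁴)/(2√(c² − 2m² + S)). Then c² − 2m² + S > 0 and 4(1 + m²c²) − c⁴ > 0 (so a, b are well defined and positive), and for every z ∈ ℂ one has the factorization (z² + m²)² − c²z² + 1 = (z² − (b − ia)²)(z² − (b + ia)²); in particular z = b − ia is a root of the quartic (z² + m²)² − c²z² + 1. -/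
open Real Complex

/-- Factorization of the quartic symbol: with
`S = √((c²−2m²)² + 4(1+c²m²) − c⁴)`, `b = (1/2)√(c²−2m²+S)` and
`a = √(4(1+m²c²)−c⁴)/(2√(c²−2m²+S))`, the radicands are positive, `a, b > 0`, and
`(z²+m²)² − c²z² + 1 = (z² − (b−ia)²)(z² − (b+ia)²)` for all `z ∈ ℂ`;
in particular `z = b − ia` is a root. -/
theorem stmt_7 (c m : ℝ) (hc : c ∈ Set.Ioo 0 (Real.sqrt 2)) (hm : 0 ≤ m)
    (S b a : ℝ)
    (hS : S = Real.sqrt ((c ^ 2 - 2 * m ^ 2) ^ 2 + 4 * (1 + c ^ 2 * m ^ 2) - c ^ 4))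
    (hb : b = (1 / 2) * Real.sqrt (c ^ 2 - 2 * m ^ 2 + S))
    (ha : a = Real.sqrt (4 * (1 + m ^ 2 * c ^ 2) - c ^ 4)
        / (2 * Real.sqrt (c ^ 2 - 2 * m ^ 2 + S))) :
    0 < c ^ 2 - 2 * m ^ 2 + S ∧
    0 < 4 * (1 + m ^ 2 * c ^ 2) - c ^ 4 ∧
    0 < a ∧ 0 < b ∧
    (∀ z : ℂ,
      (z ^ 2 + (m : ℂ) ^ 2) ^ 2 - (c : ℂ) ^ 2 * z ^ 2 + 1 =
        (z ^ 2 - ((b : ℂ) - Complex.I * (a : ℂ)) ^ 2) *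
          (z ^ 2 - ((b : ℂ) + Complex.I * (a : ℂ)) ^ 2)) ∧
    ((((b : ℂ) - Complex.I * (a : ℂ)) ^ 2 + (m : ℂ) ^ 2) ^ 2
        - (c : ℂ) ^ 2 * ((b : ℂ) - Complex.I * (a : ℂ)) ^ 2 + 1 = 0) := by
  obtain ⟨hc0, hc2⟩ := hc
  have hcsq : c ^ 2 < 2 := (Real.lt_sqrt hc0.le).mp hc2
  have hD : 0 < 4 * (1 + m ^ 2 * c ^ 2) - c ^ 4 := by
    have h1 : 0 ≤ m ^ 2 * c ^ 2 := by positivity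
    nlinarith [sq_nonneg c]
  have hS0 : 0 ≤ S := by rw [hS]; exact Real.sqrt_nonneg _
  have hSsq : S ^ 2 = (c ^ 2 - 2 * m ^ 2) ^ 2 + (4 * (1 + m ^ 2 * c ^ 2) - c ^ 4) := by
    rw [hS, Real.sq_sqrt]
    · ring
    · nlinarith [sq_nonneg (c ^ 2 - 2 * m ^ 2)]
  have hP : 0 < c ^ 2 - 2 * m ^ 2 + S := by
    have h := abs_lt_of_sq_lt_sq (a := c ^ 2 - 2 * m ^ 2) (b := S) (by linarith) hS0
    linarith [(abs_lt.mp h).1]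
  have hb2 : b ^ 2 = (c ^ 2 - 2 * m ^ 2 + S) / 4 := by
    rw [hb, mul_pow, Real.sq_sqrt hP.le]; ring
  have ha2 : a ^ 2 = (S - (c ^ 2 - 2 * m ^ 2)) / 4 := by
    rw [ha, div_pow, mul_pow, Real.sq_sqrt hP.le, Real.sq_sqrt hD.le, div_eq_iff (by positivity)]
    linear_combination -hSsq
  have hapos : 0 < a := by
    rw [ha]
    have := Real.sqrt_pos.mpr hP
    have := Real.sqrt_pos.mpr hD
    positivity
  have hbpos : 0 < b := by
    rw [hb]
    have := Real.sqrt_pos.mpr hP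
    positivity
  have e1 : 2 * (b ^ 2 - a ^ 2) = c ^ 2 - 2 * m ^ 2 := by rw [hb2, ha2]; ring
  have e2 : (b ^ 2 + a ^ 2) ^ 2 = m ^ 4 + 1 := by
    rw [hb2, ha2]; linear_combination hSsq / 4
  have e1c : 2 * ((b : ℂ) ^ 2 - (a : ℂ) ^ 2) = (c : ℂ) ^ 2 - 2 * (m : ℂ) ^ 2 := by
    exact_mod_cast e1
  have e2c : ((b : ℂ) ^ 2 + (a : ℂ) ^ 2) ^ 2 = (m : ℂ) ^ 4 + 1 := by
    exact_mod_cast e2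
  have key : ∀ z : ℂ,
      (z ^ 2 + (m : ℂ) ^ 2) ^ 2 - (c : ℂ) ^ 2 * z ^ 2 + 1 =
        (z ^ 2 - ((b : ℂ) - Complex.I * (a : ℂ)) ^ 2) *
          (z ^ 2 - ((b : ℂ) + Complex.I * (a : ℂ)) ^ 2) := by
    intro z
    have f1 : ((b : ℂ) - Complex.I * a) * (b + Complex.I * a) = b ^ 2 + a ^ 2 := by
      linear_combination -(a : ℂ) ^ 2 * Complex.I_sq
    have f2 : ((b : ℂ) - Complex.I * a) ^ 2 + (b + Complex.I * a) ^ 2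
        = 2 * (b ^ 2 - a ^ 2) := by
      linear_combination 2 * (a : ℂ) ^ 2 * Complex.I_sq
    have f3 : (((b : ℂ) - Complex.I * a) * (b + Complex.I * a)) ^ 2 = (m : ℂ) ^ 4 + 1 := by
      rw [f1, e2c]
    linear_combination z ^ 2 * f2 + z ^ 2 * e1c - f3
  refine ⟨hP, hD, hapos, hbpos, key, ?_⟩
  rw [key]
  ring
end

section
/- Let c ∈ (0,√2) and m ≥ 0, and let a, b be defined by S = √((c² − 2m²)² + 4(1 + c²m²) − c⁴), b = (1/2)√(c² − 2m² + S), a = √(4(1 + m²c²) − c⁴)/(2√(c² − 2m² + S)); set D = 4(1 + m²c²) − c⁴. Then for every x ∈ ℝ, ∫_ℝ e^{2πiξx}/(((2πξ)² + m²)² − c²(2πξ)² + 1) dξ = e^{−a|x|}(a·sin(b|x|) + b·cos(b|x|))/((a² + b²)√D). In particular the left-hand side is a real-valued, even function of x. -/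
open Real MeasureTheory

lemma exp_abs_aux (w : ℂ) (hw : 0 < w.re) (s : ℝ) :
    Integrable (fun v : ℝ => Complex.exp (-(s * v) * Complex.I) * Complex.exp (-w * ((|v| : ℝ) : ℂ)))
    ∧ ∫ v : ℝ, Complex.exp (-(s * v) * Complex.I) * Complex.exp (-w * ((|v| : ℝ) : ℂ))
      = 2 * w / (w ^ 2 + (s : ℂ) ^ 2) := by
  have hre1 : 0 < (w - s * Complex.I).re := by simpa using hw
  have hre2 : (-w - s * Complex.I).re < 0 := by simpa using hw
  have e1 : Set.EqOn (fun v : ℝ => Complex.exp ((w - s * Complex.I) * v))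
      (fun v : ℝ => Complex.exp (-(s * v) * Complex.I) * Complex.exp (-w * ((|v| : ℝ) : ℂ)))
      (Set.Iic 0) := by
    intro v hv
    have hv : v ≤ 0 := hv
    simp only
    rw [abs_of_nonpos hv, ← Complex.exp_add]
    congr 1
    push_cast
    ring
  have e2 : Set.EqOn (fun v : ℝ => Complex.exp ((-w - s * Complex.I) * v))
      (fun v : ℝ => Complex.exp (-(s * v) * Complex.I) * Complex.exp (-w * ((|v| : ℝ) : ℂ)))
      (Set.Ioi 0) := by
    intro v hv
    have hv : 0 < v := hv
    simp only
    rw [abs_of_pos hv, ← Complex.exp_add]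
    congr 1
    ring
  have i1 := (integrableOn_exp_mul_complex_Iic hre1 0).congr_fun e1 measurableSet_Iic
  have i2 := (integrableOn_exp_mul_complex_Ioi hre2 0).congr_fun e2 measurableSet_Ioi
  constructor
  · rw [← integrableOn_univ, ← Set.Iic_union_Ioi (a := (0 : ℝ))]
    exact i1.union i2
  · rw [← intervalIntegral.integral_Iic_add_Ioi i1 i2,
      ← setIntegral_congr_fun measurableSet_Iic e1, ← setIntegral_congr_fun measurableSet_Ioi e2,
      integral_exp_mul_complex_Iic hre1, integral_exp_mul_complex_Ioi hre2]
    have h1 : w - s * Complex.I ≠ 0 := fun h => by rw [h] at hre1; simp at hre1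
    have h2 : -w - s * Complex.I ≠ 0 := fun h => by rw [h] at hre2; simp at hre2
    have h3 : w ^ 2 + (s : ℂ) ^ 2 = -((w - s * Complex.I) * (-w - s * Complex.I)) := by
      linear_combination ((s : ℂ) ^ 2) * Complex.I_sq
    rw [h3]
    simp only [Complex.ofReal_zero, mul_zero, Complex.exp_zero]
    field_simp
    ring

lemma core_aux (a b : ℝ) (ha : 0 < a) (hb : 0 < b) (x : ℝ) :
    ∫ ξ : ℝ, Complex.exp (((2 * π * (ξ * x) : ℝ) : ℂ) * Complex.I) *
      ((4 * a * b * (a ^ 2 + b ^ 2) /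
        ((((2 * π * ξ) - b) ^ 2 + a ^ 2) * (((2 * π * ξ) + b) ^ 2 + a ^ 2)) : ℝ) : ℂ)
      = ((Real.exp (-(a * |x|)) * (a * Real.sin (b * |x|) + b * Real.cos (b * |x|)) : ℝ) : ℂ) := by
  set w : ℂ := a - b * Complex.I with hw
  set w' : ℂ := a + b * Complex.I with hw'
  set α : ℂ := (b - a * Complex.I) / 2 with hα
  set β : ℂ := (b + a * Complex.I) / 2 with hβ
  have hwr : 0 < w.re := by simpa [hw] using ha
  have hwr' : 0 < w'.re := by simpa [hw'] using ha
  let F : ℝ → ℂ := fun v => α * Complex.exp (-w * ((|v| : ℝ) : ℂ))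
    + β * Complex.exp (-w' * ((|v| : ℝ) : ℂ))
  have hFx : F x = ((Real.exp (-(a * |x|)) *
      (a * Real.sin (b * |x|) + b * Real.cos (b * |x|)) : ℝ) : ℂ) := by
    simp only [F]
    generalize |x| = y
    have e1 : -w * (y : ℂ) = ((-(a * y) : ℝ) : ℂ) + ((b * y : ℝ) : ℂ) * Complex.I := by
      rw [hw]; push_cast; ring
    have e2 : -w' * (y : ℂ) = ((-(a * y) : ℝ) : ℂ) + ((-(b * y) : ℝ) : ℂ) * Complex.I := by
      rw [hw']; push_cast; ring
    rw [e1, e2, Complex.exp_add, Complex.exp_add, Complex.exp_mul_I, Complex.exp_mul_I,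
      ← Complex.ofReal_exp, ← Complex.ofReal_cos, ← Complex.ofReal_sin, ← Complex.ofReal_cos,
      ← Complex.ofReal_sin, Real.cos_neg, Real.sin_neg, hα, hβ]
    push_cast
    linear_combination (-(a : ℂ) * Complex.exp (-(a * y)) * Complex.sin (b * y)) * Complex.I_sq
  have hFc : Continuous F := by
    simp only [F]; fun_prop
  have hFi : Integrable F := by
    have h1 := (exp_abs_aux w hwr 0).1
    have h2 := (exp_abs_aux w' hwr' 0).1
    simp only [Complex.ofReal_zero, zero_mul, neg_zero, Complex.exp_zero, one_mul] at h1 h2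
    exact (h1.const_mul α).add (h2.const_mul β)
  have hpos : ∀ t : ℝ, 0 < ((t - b) ^ 2 + a ^ 2) * ((t + b) ^ 2 + a ^ 2) := fun t => by positivity
  have hFF : FourierTransform.fourier F = fun ξ : ℝ => ((4 * a * b * (a ^ 2 + b ^ 2) /
        ((((2 * π * ξ) - b) ^ 2 + a ^ 2) * (((2 * π * ξ) + b) ^ 2 + a ^ 2)) : ℝ) : ℂ) := by
    ext ξ
    obtain ⟨h1, k1⟩ := exp_abs_aux w hwr (2 * π * ξ)
    obtain ⟨h2, k2⟩ := exp_abs_aux w' hwr' (2 * π * ξ)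
    rw [Real.fourier_real_eq_integral_exp_smul]
    have : ∀ v : ℝ, Complex.exp (↑(-2 * π * v * ξ) * Complex.I) • F v =
        α * (Complex.exp (-(((2 * π * ξ : ℝ) : ℂ) * v) * Complex.I)
          * Complex.exp (-w * ((|v| : ℝ) : ℂ))) +
        β * (Complex.exp (-(((2 * π * ξ : ℝ) : ℂ) * v) * Complex.I)
          * Complex.exp (-w' * ((|v| : ℝ) : ℂ))) := by
      intro v
      have e : ((-2 * π * v * ξ : ℝ) : ℂ) = -(((2 * π * ξ : ℝ) : ℂ) * v) := by push_cast; ring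
      rw [e, smul_eq_mul]
      simp only [F]
      ring
    simp_rw [this]
    rw [integral_add (h1.const_mul α) (h2.const_mul β), integral_const_mul, integral_const_mul,
      k1, k2]
    have hl := hpos (2 * π * ξ)
    generalize 2 * π * ξ = s at hl ⊢
    have hl' : (((s - b) ^ 2 + a ^ 2) * ((s + b) ^ 2 + a ^ 2) : ℂ) ≠ 0 := by
      exact_mod_cast hl.ne'
    have hprod : (w ^ 2 + (s : ℂ) ^ 2) * (w' ^ 2 + (s : ℂ) ^ 2)
        = (((s - b) ^ 2 + a ^ 2) * ((s + b) ^ 2 + a ^ 2) : ℂ) := by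
      rw [hw, hw']
      ring_nf
      simp only [Complex.I_sq, Complex.I_pow_four]
      ring
    have n1 : w ^ 2 + (s : ℂ) ^ 2 ≠ 0 := fun h => hl' (by rw [← hprod, h, zero_mul])
    have n2 : w' ^ 2 + (s : ℂ) ^ 2 ≠ 0 := fun h => hl' (by rw [← hprod, h, mul_zero])
    push_cast
    rw [← hprod, mul_div_assoc', mul_div_assoc', div_add_div _ _ n1 n2]
    congr 1
    rw [hw, hw', hα, hβ]
    ring_nf
    simp only [Complex.I_sq, Complex.I_pow_four]
    ring_nf
  have hFFi : Integrable (FourierTransform.fourier F) := by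
    rw [hFF]
    refine Integrable.ofReal (𝕜 := ℂ) (f := fun ξ : ℝ => 4 * a * b * (a ^ 2 + b ^ 2) /
        ((((2 * π * ξ) - b) ^ 2 + a ^ 2) * (((2 * π * ξ) + b) ^ 2 + a ^ 2))) ?_
    have h0 : Integrable (fun ξ : ℝ => (1 + ((2 * π * ξ - b) / a) ^ 2)⁻¹) :=
      ((integrable_inv_one_add_sq.comp_div ha.ne').comp_sub_right b).comp_mul_left'
        (R := 2 * π) (by positivity)
    refine (h0.const_mul (4 * a * b * (a ^ 2 + b ^ 2) / a ^ 4)).mono' ?_ ?_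
    · apply Continuous.aestronglyMeasurable
      refine Continuous.div (by fun_prop) (by fun_prop) (fun ξ => (hpos _).ne')
    · refine Filter.Eventually.of_forall fun ξ => ?_
      beta_reduce
      have hl := hpos (2 * π * ξ)
      generalize 2 * π * ξ = s at hl ⊢
      rw [Real.norm_of_nonneg (div_nonneg (by positivity) hl.le)]
      have : 4 * a * b * (a ^ 2 + b ^ 2) / a ^ 4 * (1 + ((s - b) / a) ^ 2)⁻¹
          = 4 * a * b * (a ^ 2 + b ^ 2) / (((s - b) ^ 2 + a ^ 2) * a ^ 2) := by
        field_simp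
        ring
      rw [this]
      gcongr
      nlinarith [sq_nonneg (s + b)]
  have key := congrFun (hFc.fourierInv_fourier_eq hFi hFFi) x
  rw [Real.fourierInv_eq', hFF, hFx] at key
  rw [← key]
  congr 1
  ext ξ
  simp [mul_comm]

/-- Explicit inverse Fourier transform of the reciprocal symbol: for every `x ∈ ℝ`,
`∫_ℝ e^{2πiξx}/(((2πξ)²+m²)² − c²(2πξ)² + 1) dξ
  = e^{−a|x|}(a sin(b|x|) + b cos(b|x|))/((a²+b²)√D)`. -/
theorem stmt_8 (c m : ℝ) (hc : c ∈ Set.Ioo 0 (Real.sqrt 2)) (hm : 0 ≤ m)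
    (S b a D : ℝ)
    (hS : S = Real.sqrt ((c ^ 2 - 2 * m ^ 2) ^ 2 + 4 * (1 + c ^ 2 * m ^ 2) - c ^ 4))
    (hb : b = (1 / 2) * Real.sqrt (c ^ 2 - 2 * m ^ 2 + S))
    (ha : a = Real.sqrt (4 * (1 + m ^ 2 * c ^ 2) - c ^ 4)
        / (2 * Real.sqrt (c ^ 2 - 2 * m ^ 2 + S)))
    (hD : D = 4 * (1 + m ^ 2 * c ^ 2) - c ^ 4) :
    ∀ x : ℝ,
      (∫ ξ : ℝ,
          Complex.exp (2 * (π : ℂ) * Complex.I * (ξ : ℂ) * (x : ℂ)) /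
            ((((2 * π * ξ) ^ 2 + m ^ 2) ^ 2 - c ^ 2 * (2 * π * ξ) ^ 2 + 1 : ℝ) : ℂ))
        = ((Real.exp (-(a * |x|)) * (a * Real.sin (b * |x|) + b * Real.cos (b * |x|))
            / ((a ^ 2 + b ^ 2) * Real.sqrt D) : ℝ) : ℂ) := by

  intro x
  obtain ⟨hc0, hc2⟩ := hc
  have hcc : c ^ 2 < 2 := by
    have := Real.sq_sqrt (show (0 : ℝ) ≤ 2 by norm_num)
    nlinarith [Real.sqrt_nonneg 2]
  have hDpos : 0 < D := by
    rw [hD]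
    nlinarith [mul_nonneg (sq_nonneg m) (sq_nonneg c), sq_nonneg c]
  have hDS : (c ^ 2 - 2 * m ^ 2) ^ 2 + 4 * (1 + c ^ 2 * m ^ 2) - c ^ 4
      = (c ^ 2 - 2 * m ^ 2) ^ 2 + D := by rw [hD]; ring
  rw [hDS] at hS
  have hS2 : S ^ 2 = (c ^ 2 - 2 * m ^ 2) ^ 2 + D := by
    rw [hS]; exact Real.sq_sqrt (by positivity)
  have hS0 : 0 ≤ S := by rw [hS]; exact Real.sqrt_nonneg _
  have hT : 0 < c ^ 2 - 2 * m ^ 2 + S := by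
    by_contra h
    push Not at h
    nlinarith
  have hTs := Real.sqrt_pos.mpr hT
  have hTq := Real.sq_sqrt hT.le
  have hDs := Real.sqrt_pos.mpr hDpos
  have hDq := Real.sq_sqrt hDpos.le
  rw [← hD] at ha
  have hb0 : 0 < b := by rw [hb]; positivity
  have ha0 : 0 < a := by rw [ha]; positivity
  have hab : 4 * a * b = √D := by
    rw [ha, hb]; field_simp; norm_num
  have hb2 : 4 * b ^ 2 = c ^ 2 - 2 * m ^ 2 + S := by
    rw [hb]; linear_combination hTq
  have ha2 : 4 * a ^ 2 = S - (c ^ 2 - 2 * m ^ 2) := by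
    have h1 : 4 * a ^ 2 * (4 * b ^ 2) = (S - (c ^ 2 - 2 * m ^ 2)) * (4 * b ^ 2) := by
      have : 4 * a ^ 2 * (4 * b ^ 2) = D := by
        rw [← hDq, ← hab]; ring
      rw [this, hb2]; linear_combination -hS2
    exact mul_right_cancel₀ (by positivity) h1
  have hk : (0 : ℝ) < (a ^ 2 + b ^ 2) * √D := by positivity
  rw [Complex.ofReal_div, ← core_aux a b ha0 hb0 x, ← integral_div]
  congr 1
  ext ξ
  have hl : ((2 * π * ξ) ^ 2 + m ^ 2) ^ 2 - c ^ 2 * (2 * π * ξ) ^ 2 + 1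
      = (((2 * π * ξ) - b) ^ 2 + a ^ 2) * (((2 * π * ξ) + b) ^ 2 + a ^ 2) := by
    generalize 2 * π * ξ = s
    have h1 : a ^ 2 = (S - (c ^ 2 - 2 * m ^ 2)) / 4 := by linarith
    have h2 : b ^ 2 = (c ^ 2 - 2 * m ^ 2 + S) / 4 := by linarith
    have : ((s - b) ^ 2 + a ^ 2) * ((s + b) ^ 2 + a ^ 2)
      = s ^ 4 + 2 * (a ^ 2 - b ^ 2) * s ^ 2 + (a ^ 2 + b ^ 2) ^ 2 := by ring
    rw [this, h1, h2]
    rw [hD] at hS2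
    linear_combination (-1 / 4) * hS2
  rw [hl, mul_div_assoc, ← Complex.ofReal_div, div_eq_mul_inv (Complex.exp _), ← Complex.ofReal_inv]
  congr 2
  · push_cast; ring
  · rw [hab]; field_simp
end

section
/- Let c ∈ (0,√2) and m ≥ 0, and let a, b be defined by S = √((c² − 2m²)² + 4(1 + c²m²) − c⁴), b = (1/2)√(c² − 2m² + S), a = √(4(1 + m²c²) − c⁴)/(2√(c² − 2m² + S)); set D = 4(1 + m²c²) − c⁴ and C = 1/(√(a² + b²)·√D). Then for every x ∈ ℝ, |∫_ℝ e^{2πiξx}/(((2πξ)² + m²)² − c²(2πξ)² + 1) dξ| ≤ C·e^{−a|x|}. -/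
open Real MeasureTheory

lemma kernel_piece (l : ℂ) (hl : 0 < l.re) (w : ℝ) :
    Integrable (fun x : ℝ => Complex.exp (((-w * x : ℝ) : ℂ) * Complex.I) *
      Complex.exp (-l * ((|x| : ℝ) : ℂ))) ∧
    ∫ x : ℝ, Complex.exp (((-w * x : ℝ) : ℂ) * Complex.I) *
      Complex.exp (-l * ((|x| : ℝ) : ℂ)) = 2 * l / ((w : ℂ) ^ 2 + l ^ 2) := by
  set F := fun x : ℝ => Complex.exp (((-w * x : ℝ) : ℂ) * Complex.I) *
      Complex.exp (-l * ((|x| : ℝ) : ℂ)) with hF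
  have h1re : (-(l + w * Complex.I)).re < 0 := by simpa using hl
  have h2re : 0 < (l - w * Complex.I).re := by simpa using hl
  have e1 : Set.EqOn F (fun x : ℝ => Complex.exp (-(l + w * Complex.I) * x)) (Set.Ioi 0) := by
    intro x hx
    simp only [hF]
    rw [abs_of_pos hx, ← Complex.exp_add]
    congr 1; push_cast; ring
  have e2 : Set.EqOn F (fun x : ℝ => Complex.exp ((l - w * Complex.I) * x)) (Set.Iic 0) := by
    intro x hx
    simp only [hF]
    rw [abs_of_nonpos hx, ← Complex.exp_add]
    congr 1; push_cast; ring
  have i1 : IntegrableOn F (Set.Ioi 0) :=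
    (integrableOn_exp_mul_complex_Ioi h1re 0).congr_fun e1.symm measurableSet_Ioi
  have i2 : IntegrableOn F (Set.Iic 0) :=
    (integrableOn_exp_mul_complex_Iic h2re 0).congr_fun e2.symm measurableSet_Iic
  refine ⟨?_, ?_⟩
  · rw [← integrableOn_univ, ← Set.Iic_union_Ioi (a := (0 : ℝ))]
    exact i2.union i1
  · rw [← intervalIntegral.integral_Iic_add_Ioi i2 i1,
      setIntegral_congr_fun measurableSet_Iic e2, setIntegral_congr_fun measurableSet_Ioi e1,
      integral_exp_mul_complex_Iic h2re, integral_exp_mul_complex_Ioi h1re]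
    have n1 : l + w * Complex.I ≠ 0 := by
      intro h; rw [h] at h1re; simp at h1re
    have n2 : l - w * Complex.I ≠ 0 := by
      intro h; rw [h] at h2re; simp at h2re
    have hp : (w : ℂ) ^ 2 + l ^ 2 = (l + w * Complex.I) * (l - w * Complex.I) := by
      linear_combination (w : ℂ) ^ 2 * Complex.I_sq
    rw [hp]
    simp only [Complex.ofReal_zero, mul_zero, Complex.exp_zero, neg_div_neg_eq]
    field_simp
    ring

lemma symbol_integrable (a b : ℝ) (ha : 0 < a) :
    Integrable (fun ξ : ℝ => ((((2 * π * ξ - b) ^ 2 + a ^ 2) *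
      ((2 * π * ξ + b) ^ 2 + a ^ 2))⁻¹ : ℝ)) := by
  have h0 := integrable_inv_one_add_sq
  have h1 := ((h0.comp_sub_right (b / a)).comp_mul_left' (R := 2 * π / a) (by positivity)).const_mul
    ((a ^ 2)⁻¹ * (a ^ 2)⁻¹)
  refine h1.mono' (by
    apply Continuous.aestronglyMeasurable
    refine Continuous.inv₀ (by fun_prop) (fun x => by positivity)) ?_
  filter_upwards with ξ
  rw [Real.norm_of_nonneg (by positivity)]
  have : (a ^ 2)⁻¹ * (a ^ 2)⁻¹ * (1 + (2 * π / a * ξ - b / a) ^ 2)⁻¹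
      = (((2 * π * ξ - b) ^ 2 + a ^ 2) * a ^ 2)⁻¹ := by
    rw [← mul_inv, ← mul_inv]; congr 1
    field_simp
    ring
  rw [this]
  gcongr
  nlinarith [sq_nonneg (2 * π * ξ + b)]

lemma kernel_bound (a b : ℝ) (ha : 0 < a) (hb : 0 < b) (x : ℝ) :
    ‖∫ ξ : ℝ, Complex.exp (2 * (π : ℂ) * Complex.I * (ξ : ℂ) * (x : ℂ)) /
      ((((2 * π * ξ - b) ^ 2 + a ^ 2) * ((2 * π * ξ + b) ^ 2 + a ^ 2) : ℝ) : ℂ)‖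
      ≤ 1 / (√(a ^ 2 + b ^ 2) * (4 * a * b)) * Real.exp (-(a * |x|)) := by
  set l : ℂ := a - b * Complex.I with hl
  set n : ℂ := a + b * Complex.I with hn
  have hlre : l.re = a := by simp [hl]
  have hnre : n.re = a := by simp [hn]
  have l0 : l ≠ 0 := by intro h; rw [h] at hlre; simp at hlre; exact ha.ne hlre
  have n0 : n ≠ 0 := by intro h; rw [h] at hnre; simp at hnre; exact ha.ne hnre
  set A : ℂ := 1 / (4 * a * b * Complex.I) with hA
  have ha0 : (a : ℂ) ≠ 0 := by exact_mod_cast ha.ne'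
  have hb0 : (b : ℂ) ≠ 0 := by exact_mod_cast hb.ne'
  set g : ℝ → ℂ := fun y => A / (2 * l) * Complex.exp (-l * ((|y| : ℝ) : ℂ)) -
    A / (2 * n) * Complex.exp (-n * ((|y| : ℝ) : ℂ)) with hg
  have hgc : Continuous g := by rw [hg]; fun_prop
  have hgi : Integrable g := by
    have p1 := (kernel_piece l (by rw [hlre]; exact ha) 0).1.const_mul (A / (2 * l))
    have p2 := (kernel_piece n (by rw [hnre]; exact ha) 0).1.const_mul (A / (2 * n))
    refine (p1.sub p2).congr (Filter.Eventually.of_forall fun y => ?_)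
    simp [hg]
  have hfour : FourierTransform.fourier g = fun ξ : ℝ =>
      (((((2 * π * ξ - b) ^ 2 + a ^ 2) * ((2 * π * ξ + b) ^ 2 + a ^ 2))⁻¹ : ℝ) : ℂ) := by
    ext ξ
    obtain ⟨i1, v1⟩ := kernel_piece l (by rw [hlre]; exact ha) (2 * π * ξ)
    obtain ⟨i2, v2⟩ := kernel_piece n (by rw [hnre]; exact ha) (2 * π * ξ)
    rw [Real.fourier_real_eq_integral_exp_smul]
    have e : ∀ v : ℝ, Complex.exp (((-2 * π * v * ξ : ℝ) : ℂ) * Complex.I) • g v =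
        A / (2 * l) * (Complex.exp (((-(2 * π * ξ) * v : ℝ) : ℂ) * Complex.I) *
          Complex.exp (-l * ((|v| : ℝ) : ℂ))) -
        A / (2 * n) * (Complex.exp (((-(2 * π * ξ) * v : ℝ) : ℂ) * Complex.I) *
          Complex.exp (-n * ((|v| : ℝ) : ℂ))) := by
      intro v
      have : -2 * π * v * ξ = -(2 * π * ξ) * v := by ring
      rw [this, smul_eq_mul, hg]; ring
    simp_rw [e]
    rw [integral_sub (i1.const_mul _) (i2.const_mul _), integral_const_mul, integral_const_mul,
      v1, v2]
    set w : ℝ := 2 * π * ξ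
    have q : (((w - b) ^ 2 + a ^ 2) * ((w + b) ^ 2 + a ^ 2) : ℝ) ≠ 0 := by positivity
    have q' : ((w : ℂ) ^ 2 + l ^ 2) * ((w : ℂ) ^ 2 + n ^ 2) =
        ((((w - b) ^ 2 + a ^ 2) * ((w + b) ^ 2 + a ^ 2) : ℝ) : ℂ) := by
      have hl2 : l ^ 2 = a ^ 2 - b ^ 2 - 2 * a * b * Complex.I := by
        rw [hl]; linear_combination (b : ℂ) ^ 2 * Complex.I_sq
      have hn2 : n ^ 2 = a ^ 2 - b ^ 2 + 2 * a * b * Complex.I := by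
        rw [hn]; linear_combination (b : ℂ) ^ 2 * Complex.I_sq
      rw [hl2, hn2]; push_cast
      linear_combination -(4 * (a : ℂ) ^ 2 * b ^ 2) * Complex.I_sq
    have q0 : ((w : ℂ) ^ 2 + l ^ 2) * ((w : ℂ) ^ 2 + n ^ 2) ≠ 0 := by
      rw [q']; exact_mod_cast q
    have q1 := left_ne_zero_of_mul q0
    have q2 := right_ne_zero_of_mul q0
    rw [Complex.ofReal_inv, ← q', hA]
    have hd : n ^ 2 - l ^ 2 = 4 * a * b * Complex.I := by rw [hl, hn]; ring
    have hd0 : n ^ 2 - l ^ 2 ≠ 0 := by rw [hd]; simp [ha0, hb0]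
    rw [← hd]
    clear_value l n w
    field_simp
    ring
  have hinv := congrFun (hgc.fourierInv_fourier_eq hgi (by
    rw [hfour]; exact (symbol_integrable a b ha).ofReal)) x
  rw [Real.fourierInv_eq', hfour] at hinv
  have heq : (∫ ξ : ℝ, Complex.exp (2 * (π : ℂ) * Complex.I * (ξ : ℂ) * (x : ℂ)) /
      ((((2 * π * ξ - b) ^ 2 + a ^ 2) * ((2 * π * ξ + b) ^ 2 + a ^ 2) : ℝ) : ℂ)) = g x := by
    rw [← hinv]
    congr 1 with ξ
    beta_reduce
    rw [smul_eq_mul, Complex.ofReal_inv, div_eq_mul_inv]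
    congr 2
    simp
    ring
  rw [heq, hg]
  have nl : ‖l‖ = √(a ^ 2 + b ^ 2) := by
    rw [Complex.norm_def, Complex.normSq_apply]; simp [hl, sq]
  have nn : ‖n‖ = √(a ^ 2 + b ^ 2) := by
    rw [Complex.norm_def, Complex.normSq_apply]; simp [hn, sq]
  have nA : ‖A‖ = 1 / (4 * a * b) := by
    simp [hA, abs_of_pos ha, abs_of_pos hb]
  refine (norm_sub_le _ _).trans (le_of_eq ?_)
  have x1 : ‖Complex.exp (-l * ((|x| : ℝ) : ℂ))‖ = Real.exp (-(a * |x|)) := by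
    rw [Complex.norm_exp, Complex.re_mul_ofReal, Complex.neg_re, hlre, neg_mul]
  have x2 : ‖Complex.exp (-n * ((|x| : ℝ) : ℂ))‖ = Real.exp (-(a * |x|)) := by
    rw [Complex.norm_exp, Complex.re_mul_ofReal, Complex.neg_re, hnre, neg_mul]
  clear_value A l n
  rw [norm_mul, norm_mul, norm_div, norm_div, norm_mul 2 l, norm_mul 2 n, x1, x2, nl, nn, nA]
  have : 0 < √(a ^ 2 + b ^ 2) := by positivity
  simp only [Complex.norm_ofNat]
  field_simp
  ring

/-- Exponential decay estimate for the kernel `f = ℱ⁻¹(1/l)`: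
`|∫_ℝ e^{2πiξx}/(((2πξ)²+m²)² − c²(2πξ)² + 1) dξ| ≤ C e^{−a|x|}`
with `C = 1/(√(a²+b²)√D)`. -/
theorem stmt_9 (c m : ℝ) (hc : c ∈ Set.Ioo 0 (Real.sqrt 2)) (hm : 0 ≤ m)
    (S b a D C : ℝ)
    (hS : S = Real.sqrt ((c ^ 2 - 2 * m ^ 2) ^ 2 + 4 * (1 + c ^ 2 * m ^ 2) - c ^ 4))
    (hb : b = (1 / 2) * Real.sqrt (c ^ 2 - 2 * m ^ 2 + S))
    (ha : a = Real.sqrt (4 * (1 + m ^ 2 * c ^ 2) - c ^ 4)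
        / (2 * Real.sqrt (c ^ 2 - 2 * m ^ 2 + S)))
    (hD : D = 4 * (1 + m ^ 2 * c ^ 2) - c ^ 4)
    (hC : C = 1 / (Real.sqrt (a ^ 2 + b ^ 2) * Real.sqrt D)) :
    ∀ x : ℝ,
      ‖∫ ξ : ℝ,
          Complex.exp (2 * (π : ℂ) * Complex.I * (ξ : ℂ) * (x : ℂ)) /
            ((((2 * π * ξ) ^ 2 + m ^ 2) ^ 2 - c ^ 2 * (2 * π * ξ) ^ 2 + 1 : ℝ) : ℂ)‖
        ≤ C * Real.exp (-(a * |x|)) := by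
  have hc0 := hc.1
  have hc2 : c ^ 2 < 2 := by
    have := Real.sq_sqrt (show (0 : ℝ) ≤ 2 by norm_num)
    nlinarith [hc.2, Real.sqrt_nonneg 2]
  have hDpos : 0 < D := by
    rw [hD]; nlinarith [mul_nonneg (sq_nonneg m) (sq_nonneg c), sq_nonneg c]
  set q := c ^ 2 - 2 * m ^ 2 with hq
  have hS' : S = √(q ^ 2 + D) := by rw [hS, hD]; congr 1; ring
  have hS2 : S ^ 2 = q ^ 2 + D := by rw [hS']; exact Real.sq_sqrt (by positivity)
  have hS0 : 0 ≤ S := by rw [hS']; positivity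
  have hqS : 0 < q + S := by
    by_contra h
    push Not at h
    nlinarith
  rw [← hD] at ha
  set T := √(q + S) with hT
  have hTpos : 0 < T := Real.sqrt_pos.2 hqS
  have hT2 : T ^ 2 = q + S := Real.sq_sqrt hqS.le
  set R := √D with hR
  have hRpos : 0 < R := Real.sqrt_pos.2 hDpos
  have hR2 : R ^ 2 = D := Real.sq_sqrt hDpos.le
  have hbpos : 0 < b := by rw [hb]; positivity
  have hapos : 0 < a := by rw [ha]; positivity
  have hab : R = 4 * a * b := by rw [ha, hb]; field_simp; norm_num
  have hb2 : b ^ 2 = (q + S) / 4 := by rw [hb, mul_pow, hT2]; ring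
  have ha2 : a ^ 2 = (S - q) / 4 := by
    rw [ha, div_pow, mul_pow, hT2, hR2]
    field_simp
    linear_combination -4 * hS2
  intro x
  rw [hC, hab]
  have key := kernel_bound a b hapos hbpos x
  have hfac : ∀ ξ : ℝ, ((2 * π * ξ) ^ 2 + m ^ 2) ^ 2 - c ^ 2 * (2 * π * ξ) ^ 2 + 1 =
      ((2 * π * ξ - b) ^ 2 + a ^ 2) * ((2 * π * ξ + b) ^ 2 + a ^ 2) := by
    intro ξ
    generalize 2 * π * ξ = w
    have : ((w - b) ^ 2 + a ^ 2) * ((w + b) ^ 2 + a ^ 2) =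
      w ^ 4 + 2 * w ^ 2 * (a ^ 2 - b ^ 2) + (a ^ 2 + b ^ 2) ^ 2 := by ring
    rw [this, ha2, hb2]
    have h4 : S ^ 2 = 4 * (1 + m ^ 4) := by rw [hS2, hD, hq]; ring
    rw [hq]
    linear_combination -(1 / 4 : ℝ) * h4
  simp_rw [hfac]
  exact key
end

section
/- Let c ∈ (0,√2) and m ≥ 0. For μ < 1 − c⁴/4 define b(μ) = (1/2)√(c² − 2m² + √((c² − 2m²)² + 4(1 + c²m² − μ) − c⁴)) and a(μ) = √(4(1 + m²c² − μ) − c⁴)/(2√(c² − 2m² + √((c² − 2m²)² + 4(1 + c²m² − μ) − c⁴))). Then for all μ < 1 − c⁴/4 the quantities under the square roots are positive (so a(μ), b(μ) are well defined and positive), and both μ ↦ a(μ) and μ ↦ b(μ) are strictly decreasing on (−∞, 1 − c⁴/4). -/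
open Real

/-- Decay rate `a(μ)` and oscillation frequency `b(μ)` of the kernel of `(𝕃_{n₂} − μI)⁻¹`
are well defined and positive for `μ < 1 − c⁴/4`, and both are strictly decreasing in `μ`
on `(−∞, 1 − c⁴/4)`. -/
theorem stmt_10 (c m : ℝ) (hc : c ∈ Set.Ioo 0 (Real.sqrt 2)) (hm : 0 ≤ m)
    (b a : ℝ → ℝ)
    (hb : ∀ μ : ℝ, b μ = (1 / 2) * Real.sqrt (c ^ 2 - 2 * m ^ 2 +
        Real.sqrt ((c ^ 2 - 2 * m ^ 2) ^ 2 + 4 * (1 + c ^ 2 * m ^ 2 - μ) - c ^ 4)))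
    (ha : ∀ μ : ℝ, a μ = Real.sqrt (4 * (1 + m ^ 2 * c ^ 2 - μ) - c ^ 4)
        / (2 * Real.sqrt (c ^ 2 - 2 * m ^ 2 +
            Real.sqrt ((c ^ 2 - 2 * m ^ 2) ^ 2 + 4 * (1 + c ^ 2 * m ^ 2 - μ) - c ^ 4)))) :
    (∀ μ : ℝ, μ < 1 - c ^ 4 / 4 →
      0 < 4 * (1 + m ^ 2 * c ^ 2 - μ) - c ^ 4 ∧
      0 < (c ^ 2 - 2 * m ^ 2) ^ 2 + 4 * (1 + c ^ 2 * m ^ 2 - μ) - c ^ 4 ∧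
      0 < c ^ 2 - 2 * m ^ 2 +
          Real.sqrt ((c ^ 2 - 2 * m ^ 2) ^ 2 + 4 * (1 + c ^ 2 * m ^ 2 - μ) - c ^ 4) ∧
      0 < a μ ∧ 0 < b μ) ∧
    StrictAntiOn a (Set.Iio (1 - c ^ 4 / 4)) ∧
    StrictAntiOn b (Set.Iio (1 - c ^ 4 / 4)) := by
  have hD : ∀ μ : ℝ, μ < 1 - c ^ 4 / 4 → 0 < 4 * (1 + m ^ 2 * c ^ 2 - μ) - c ^ 4 := by
    intro μ h
    nlinarith [mul_nonneg (sq_nonneg m) (sq_nonneg c)]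
  have hE : ∀ μ : ℝ, μ < 1 - c ^ 4 / 4 →
      (c ^ 2 - 2 * m ^ 2) ^ 2 < (c ^ 2 - 2 * m ^ 2) ^ 2 + 4 * (1 + c ^ 2 * m ^ 2 - μ) - c ^ 4 := by
    intro μ h
    linarith [hD μ h, mul_comm (m ^ 2) (c ^ 2)]
  have hS : ∀ μ : ℝ, μ < 1 - c ^ 4 / 4 → |c ^ 2 - 2 * m ^ 2| <
      Real.sqrt ((c ^ 2 - 2 * m ^ 2) ^ 2 + 4 * (1 + c ^ 2 * m ^ 2 - μ) - c ^ 4) := by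
    intro μ h
    apply Real.lt_sqrt_of_sq_lt
    rw [sq_abs]
    exact hE μ h
  have hmono : ∀ μ ν : ℝ, ν < 1 - c ^ 4 / 4 → μ < ν →
      Real.sqrt ((c ^ 2 - 2 * m ^ 2) ^ 2 + 4 * (1 + c ^ 2 * m ^ 2 - ν) - c ^ 4) <
      Real.sqrt ((c ^ 2 - 2 * m ^ 2) ^ 2 + 4 * (1 + c ^ 2 * m ^ 2 - μ) - c ^ 4) := by
    intro μ ν h h'
    apply Real.sqrt_lt_sqrt
    · exact ((sq_nonneg _).trans_lt (hE ν h)).le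
    · linarith
  have ha' : ∀ μ : ℝ, μ < 1 - c ^ 4 / 4 → a μ = (1 / 2) * Real.sqrt (
      Real.sqrt ((c ^ 2 - 2 * m ^ 2) ^ 2 + 4 * (1 + c ^ 2 * m ^ 2 - μ) - c ^ 4)
        - (c ^ 2 - 2 * m ^ 2)) := by
    intro μ h
    have h1 := Real.sq_sqrt ((sq_nonneg _).trans_lt (hE μ h)).le
    obtain ⟨h2, h3⟩ := abs_lt.mp (hS μ h)
    rw [ha μ]
    set S := Real.sqrt ((c ^ 2 - 2 * m ^ 2) ^ 2 + 4 * (1 + c ^ 2 * m ^ 2 - μ) - c ^ 4)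
    have h4 : 4 * (1 + m ^ 2 * c ^ 2 - μ) - c ^ 4 =
        (S - (c ^ 2 - 2 * m ^ 2)) * (c ^ 2 - 2 * m ^ 2 + S) := by
      linear_combination -h1
    have h5 : 0 < Real.sqrt (c ^ 2 - 2 * m ^ 2 + S) := Real.sqrt_pos.mpr (by linarith)
    rw [h4, Real.sqrt_mul (by linarith)]
    field_simp
  refine ⟨fun μ h => ?_, ?_, ?_⟩
  · obtain ⟨h2, h3⟩ := abs_lt.mp (hS μ h)
    refine ⟨hD μ h, (sq_nonneg _).trans_lt (hE μ h), by linarith, ?_, ?_⟩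
    · rw [ha' μ h]
      exact mul_pos (by norm_num) (Real.sqrt_pos.mpr (by linarith))
    · rw [hb μ]
      exact mul_pos (by norm_num) (Real.sqrt_pos.mpr (by linarith))
  · intro μ hμ ν hν hlt
    obtain ⟨h2, h3⟩ := abs_lt.mp (hS ν hν)
    rw [ha' μ hμ, ha' ν hν]
    exact mul_lt_mul_of_pos_left
      (Real.sqrt_lt_sqrt (by linarith) (by linarith [hmono μ ν hν hlt])) (by norm_num)
  · intro μ hμ ν hν hlt
    obtain ⟨h2, h3⟩ := abs_lt.mp (hS ν hν)
    rw [hb μ, hb ν]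
    exact mul_lt_mul_of_pos_left
      (Real.sqrt_lt_sqrt (by linarith) (by linarith [hmono μ ν hν hlt])) (by norm_num)
end

section
/- Let c ∈ (0,√2) and define l : ℝ² → ℝ by l(ξ) = |2πξ|⁴ − c²(2πξ₁)² + 1. Then for every ξ ∈ ℝ², (2πξ₁)²/l(ξ) ≤ 1/(2 − c²), with equality attained (e.g. at ξ₂ = 0 and (2πξ₁)² = 1); hence sup_{ξ∈ℝ²}(2πξ₁)²/l(ξ) = 1/(2 − c²). -/
open Real

/-- For `c ∈ (0,√2)`, `(2πξ₁)²/l(ξ) ≤ 1/(2−c²)` for all `ξ`, with equality attained at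
`ξ₂ = 0`, `(2πξ₁)² = 1`; hence the supremum equals `1/(2−c²)`. -/
theorem stmt_12 (c : ℝ) (hc : c ∈ Set.Ioo 0 (Real.sqrt 2))
    (l : ℝ × ℝ → ℝ)
    (hl : ∀ ξ : ℝ × ℝ,
      l ξ = ((2 * π * ξ.1) ^ 2 + (2 * π * ξ.2) ^ 2) ^ 2 - c ^ 2 * (2 * π * ξ.1) ^ 2 + 1) :
    (∀ ξ : ℝ × ℝ, (2 * π * ξ.1) ^ 2 / l ξ ≤ 1 / (2 - c ^ 2)) ∧
    (∀ ξ : ℝ × ℝ, ξ.2 = 0 → (2 * π * ξ.1) ^ 2 = 1 →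
      (2 * π * ξ.1) ^ 2 / l ξ = 1 / (2 - c ^ 2)) ∧
    IsGreatest (Set.range fun ξ : ℝ × ℝ => (2 * π * ξ.1) ^ 2 / l ξ) (1 / (2 - c ^ 2)) := by
  obtain ⟨h0, h1⟩ := hc
  have hc2 : 0 < 2 - c ^ 2 := by
    have h := (Real.lt_sqrt h0.le).1 h1
    linarith
  have A : ∀ ξ : ℝ × ℝ, (2 * π * ξ.1) ^ 2 / l ξ ≤ 1 / (2 - c ^ 2) := by
    intro ξ
    rw [hl]
    have ha : 0 ≤ (2 * π * ξ.1) ^ 2 := sq_nonneg _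
    have hb : 0 ≤ (2 * π * ξ.2) ^ 2 := sq_nonneg _
    generalize (2 * π * ξ.1) ^ 2 = a at *
    generalize (2 * π * ξ.2) ^ 2 = b at *
    have hab : a ^ 2 ≤ (a + b) ^ 2 := pow_le_pow_left₀ ha (by linarith) 2
    have key : (2 - c ^ 2) * a ≤ (a + b) ^ 2 - c ^ 2 * a + 1 := by
      nlinarith [sq_nonneg (a - 1)]
    have hpos : 0 < (a + b) ^ 2 - c ^ 2 * a + 1 := by
      rcases ha.eq_or_lt with h | h
      · subst h
        nlinarith [sq_nonneg b]
      · exact lt_of_lt_of_le (mul_pos hc2 h) key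
    rw [div_le_div_iff₀ hpos hc2]
    linarith
  have B : ∀ ξ : ℝ × ℝ, ξ.2 = 0 → (2 * π * ξ.1) ^ 2 = 1 →
      (2 * π * ξ.1) ^ 2 / l ξ = 1 / (2 - c ^ 2) := by
    intro ξ h2 h
    rw [hl, h, h2]
    congr 1
    ring
  refine ⟨A, B, ⟨(1 / (2 * π), 0), B _ rfl ?_⟩, ?_⟩
  · have := Real.pi_pos
    field_simp
  · rintro _ ⟨ξ, rfl⟩
    exact A ξ
end
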